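/- arXiv:2512.18350 — 2 statements merged into one kernel-verified Lean document; each statement's English description precedes it below -/
import Mathlib

section
/- Let s ∈ (0,1), let N > 2s be an integer, and let t ∈ (0, 2s). Set 2* = 2(N−t)/(N−2s) and q = 2·2*/(2*−2). Then there exist constants C > 0 and A₀ ≥ 1, depending only on N, s, t, such that for all 0 < r < R with R/r ≥ A₀, the function F_{r,R}(x) = ∫_{ℝ^N} (φ_{r,R}(x) − φ_{r,R}(y)) |x−y|^{−(N+s)} dy satisfies ∫_{|x| < r} |x|^{qt/2*} |F_{r,R}(x)|^q dx ≤ C (log(R/r))^{−q/2}. -/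
open MeasureTheory

/-- The logarithmic cutoff `φ_{r,R}` : `1` for `|x| < r`, `log(R/|x|)/log(R/r)` for
`r ≤ |x| ≤ R`, and `0` for `|x| > R`. -/
noncomputable def logCutoff (N : ℕ) (r R : ℝ) (x : EuclideanSpace ℝ (Fin N)) : ℝ :=
  if ‖x‖ < r then 1
  else if ‖x‖ ≤ R then Real.log (R / ‖x‖) / Real.log (R / r)
  else 0

/-- `F_{r,R}(x) = ∫ (φ_{r,R}(x) - φ_{r,R}(y)) |x-y|^{-(N+s)} dy`, representing
`(-Δ)^{s/2} φ_{r,R}` up to a positive dimensional constant. -/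
noncomputable def cutoffFracLap (N : ℕ) (s r R : ℝ) (x : EuclideanSpace ℝ (Fin N)) : ℝ :=
  ∫ y : EuclideanSpace ℝ (Fin N),
    (logCutoff N r R x - logCutoff N r R y) * ‖x - y‖ ^ (-((N : ℝ) + s))

theorem integrableOn_pow_smul_log_mul_rpow {N : ℕ} (hN : 0 < N) {s : ℝ}
    (hs : s ∈ Set.Ioo (0 : ℝ) 1) :
    IntegrableOn (fun y : ℝ => y ^ (N - 1) • (Real.log (1 + y) * y ^ (-((N : ℝ) + s))))
      (Set.Ioi 0) := by
  obtain ⟨hs0, hs1⟩ := hs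
  have hmeas : Measurable
      (fun y : ℝ => y ^ (N - 1) • (Real.log (1 + y) * y ^ (-((N : ℝ) + s)))) := by fun_prop
  have hpow : ∀ y : ℝ, 0 < y → y ^ (N - 1) • (Real.log (1 + y) * y ^ (-((N : ℝ) + s)))
      = Real.log (1 + y) * y ^ (-1 - s) := by
    intro y hy
    have h : y ^ (-1 - s) = y ^ (N - 1) * y ^ (-((N : ℝ) + s)) := by
      rw [← Real.rpow_natCast, ← Real.rpow_add hy, Nat.cast_sub hN]
      congr 1
      push_cast
      ring
    rw [h, smul_eq_mul]
    ring
  have hnonneg : ∀ y : ℝ, 0 < y → 0 ≤ Real.log (1 + y) * y ^ (-1 - s) := fun y hy =>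
    mul_nonneg (Real.log_nonneg (by linarith)) (Real.rpow_nonneg hy.le _)
  rw [← Set.Ioc_union_Ioi_eq_Ioi zero_le_one]
  refine IntegrableOn.union ?_ ?_
  · have hI : IntegrableOn (fun y : ℝ => y ^ (-s)) (Set.Ioc 0 1) :=
      (intervalIntegrable_iff_integrableOn_Ioc_of_le zero_le_one).1
        (intervalIntegral.intervalIntegrable_rpow' (by linarith))
    refine Integrable.mono' hI hmeas.aestronglyMeasurable ?_
    refine (ae_restrict_iff' measurableSet_Ioc).2 (Filter.Eventually.of_forall fun y hy => ?_)
    rw [hpow y hy.1, Real.norm_of_nonneg (hnonneg y hy.1)]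
    calc Real.log (1 + y) * y ^ (-1 - s) ≤ y ^ (1 : ℝ) * y ^ (-1 - s) := by
          refine mul_le_mul_of_nonneg_right ?_ (Real.rpow_nonneg hy.1.le _)
          rw [Real.rpow_one]
          linarith [Real.log_le_sub_one_of_pos (show 0 < 1 + y by linarith [hy.1])]
      _ = y ^ (-s) := by
          rw [← Real.rpow_add hy.1]
          congr 1
          ring
  · have hI : IntegrableOn (fun y : ℝ => 2 ^ (s / 2) / (s / 2) * y ^ (-1 - s / 2))
        (Set.Ioi 1) :=
      (integrableOn_Ioi_rpow_of_lt (by linarith) zero_lt_one).const_mul _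
    refine Integrable.mono' hI hmeas.aestronglyMeasurable ?_
    refine (ae_restrict_iff' measurableSet_Ioi).2 (Filter.Eventually.of_forall fun y hy => ?_)
    have hy1 : 1 < y := hy
    have hy0 : 0 < y := by linarith
    rw [hpow y hy0, Real.norm_of_nonneg (hnonneg y hy0)]
    calc Real.log (1 + y) * y ^ (-1 - s)
        ≤ ((2 * y) ^ (s / 2) / (s / 2)) * y ^ (-1 - s) := by
          refine mul_le_mul_of_nonneg_right ?_ (Real.rpow_nonneg hy0.le _)
          exact (Real.log_le_log (by linarith) (by linarith)).trans
            (Real.log_le_rpow_div (by linarith) (by linarith))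
      _ = 2 ^ (s / 2) / (s / 2) * y ^ (-1 - s / 2) := by
          have h : y ^ (-1 - s / 2) = y ^ (s / 2) * y ^ (-1 - s) := by
            rw [← Real.rpow_add hy0]
            congr 1
            ring
          rw [Real.mul_rpow zero_le_two hy0.le, h]
          ring

theorem integrable_log_one_add_norm_mul_rpow {N : ℕ} (hN : 0 < N) {s : ℝ}
    (hs : s ∈ Set.Ioo (0 : ℝ) 1) :
    Integrable (fun z : EuclideanSpace ℝ (Fin N) =>
      Real.log (1 + ‖z‖) * ‖z‖ ^ (-((N : ℝ) + s))) := by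
  have : Nonempty (Fin N) := ⟨⟨0, hN⟩⟩
  refine (integrable_fun_norm_addHaar (volume : Measure (EuclideanSpace ℝ (Fin N)))
    (f := fun y => Real.log (1 + y) * y ^ (-((N : ℝ) + s)))).2 ?_
  simpa only [finrank_euclideanSpace_fin] using integrableOn_pow_smul_log_mul_rpow hN hs

theorem abs_logCutoff_sub_le {N : ℕ} {r R : ℝ} (hr : 0 < r) (hR : r < R)
    {x : EuclideanSpace ℝ (Fin N)} (hx : ‖x‖ < r) (y : EuclideanSpace ℝ (Fin N)) :
    |logCutoff N r R x - logCutoff N r R y|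
      ≤ Real.log (1 + ‖r⁻¹ • (x - y)‖) / Real.log (R / r) := by
  have hL : 0 < Real.log (R / r) := Real.log_pos ((one_lt_div hr).2 hR)
  have hnorm : ‖r⁻¹ • (x - y)‖ = ‖x - y‖ / r := by
    rw [norm_smul, norm_inv, Real.norm_of_nonneg hr.le]
    field_simp
  have hlog : 0 ≤ Real.log (1 + ‖r⁻¹ • (x - y)‖) :=
    Real.log_nonneg (by linarith [norm_nonneg (r⁻¹ • (x - y))])
  have hxy : ‖y‖ / r ≤ 1 + ‖r⁻¹ • (x - y)‖ := by
    rw [hnorm, div_le_iff₀ hr, add_mul, div_mul_cancel₀ _ hr.ne']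
    have := norm_sub_norm_le y x
    rw [norm_sub_rev] at this
    linarith
  simp only [logCutoff, hx, if_true]
  split_ifs with h1 h2
  · simpa using div_nonneg hlog hL.le
  · have hy : 0 < ‖y‖ := by linarith
    have hrew : 1 - Real.log (R / ‖y‖) / Real.log (R / r)
        = Real.log (‖y‖ / r) / Real.log (R / r) := by
      rw [eq_div_iff hL.ne', sub_mul, div_mul_cancel₀ _ hL.ne',
        Real.log_div (by linarith) hy.ne', Real.log_div (by linarith) hr.ne',
        Real.log_div hy.ne' hr.ne']
      ring
    rw [hrew, abs_of_nonneg (div_nonneg (Real.log_nonneg ((one_le_div hr).2 (by linarith))) hL.le)]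
    exact div_le_div_of_nonneg_right (Real.log_le_log (by positivity) hxy) hL.le
  · rw [sub_zero, abs_one, one_le_div hL]
    refine Real.log_le_log (div_pos (by linarith) hr) (le_trans ?_ hxy)
    exact div_le_div_of_nonneg_right (by linarith) hr.le

theorem abs_cutoffFracLap_le {N : ℕ} (hN : 0 < N) {s : ℝ} (hs : s ∈ Set.Ioo (0 : ℝ) 1)
    {r R : ℝ} (hr : 0 < r) (hR : r < R) {x : EuclideanSpace ℝ (Fin N)} (hx : ‖x‖ < r) :
    |cutoffFracLap N s r R x|
      ≤ (∫ z : EuclideanSpace ℝ (Fin N), Real.log (1 + ‖z‖) * ‖z‖ ^ (-((N : ℝ) + s)))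
        * r ^ (-s) / Real.log (R / r) := by
  set H : EuclideanSpace ℝ (Fin N) → ℝ :=
    fun z => Real.log (1 + ‖z‖) * ‖z‖ ^ (-((N : ℝ) + s)) with hH
  set c : ℝ := r ^ (-((N : ℝ) + s)) / Real.log (R / r) with hc
  have hint : Integrable (fun y => c * H (r⁻¹ • (x - y))) :=
    (((integrable_log_one_add_norm_mul_rpow hN hs).comp_smul
      (inv_ne_zero hr.ne')).comp_sub_left x).const_mul c
  have hbound : ∀ y, ‖(logCutoff N r R x - logCutoff N r R y) * ‖x - y‖ ^ (-((N : ℝ) + s))‖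
      ≤ c * H (r⁻¹ • (x - y)) := by
    intro y
    have hscale : ‖x - y‖ ^ (-((N : ℝ) + s))
        = r ^ (-((N : ℝ) + s)) * ‖r⁻¹ • (x - y)‖ ^ (-((N : ℝ) + s)) := by
      rw [← Real.mul_rpow hr.le (norm_nonneg _), norm_smul, norm_inv,
        Real.norm_of_nonneg hr.le, mul_inv_cancel_left₀ hr.ne']
    rw [norm_mul, Real.norm_eq_abs,
      Real.norm_of_nonneg (Real.rpow_nonneg (norm_nonneg (x - y)) _)]
    refine (mul_le_mul_of_nonneg_right (abs_logCutoff_sub_le hr hR hx y)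
      (Real.rpow_nonneg (norm_nonneg _) _)).trans (le_of_eq ?_)
    rw [hscale, hc, hH]
    ring
  have h := norm_integral_le_of_norm_le hint (Filter.Eventually.of_forall hbound)
  refine h.trans (le_of_eq ?_)
  rw [integral_const_mul, integral_sub_left_eq_self (fun z => H (r⁻¹ • z)) volume x,
    Measure.integral_comp_inv_smul, finrank_euclideanSpace_fin, abs_of_pos (pow_pos hr N),
    smul_eq_mul, hc]
  have hsplit : r ^ (-s) = r ^ (-((N : ℝ) + s)) * r ^ N := by
    rw [← Real.rpow_natCast, ← Real.rpow_add hr]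
    congr 1
    ring
  rw [hsplit]
  ring

/-- For `s ∈ (0,1)`, integer `N > 2s`, `t ∈ (0,2s)`,
`2* = 2(N-t)/(N-2s)`, `q = 2·2*/(2*-2)`: there are `C > 0`, `A₀ ≥ 1` depending only on
`N, s, t` such that for all `0 < r < R` with `R/r ≥ A₀`,
`∫_{|x|<r} |x|^{qt/2*} |F_{r,R}(x)|^q dx ≤ C (log(R/r))^{-q/2}`. -/
theorem statement3 (N : ℕ) (s t : ℝ) (hs : s ∈ Set.Ioo (0 : ℝ) 1) (hN : 2 * s < N)
    (ht : t ∈ Set.Ioo (0 : ℝ) (2 * s)) (twoStar q : ℝ)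
    (htwoStar : twoStar = 2 * ((N : ℝ) - t) / ((N : ℝ) - 2 * s))
    (hq : q = 2 * twoStar / (twoStar - 2)) :
    ∃ C A₀ : ℝ, 0 < C ∧ 1 ≤ A₀ ∧ ∀ r R : ℝ, 0 < r → r < R → A₀ ≤ R / r →
      ∫⁻ x in {x : EuclideanSpace ℝ (Fin N) | ‖x‖ < r},
          ENNReal.ofReal (‖x‖ ^ (q * t / twoStar) * |cutoffFracLap N s r R x| ^ q)
        ≤ ENNReal.ofReal (C * Real.log (R / r) ^ (-(q / 2))) := by
  obtain ⟨ht0, ht1⟩ := ht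
  have hs0 := hs.1
  have hNpos : 0 < N := by
    have : (0 : ℝ) < N := by linarith
    exact_mod_cast this
  have hd1 : 0 < (N : ℝ) - 2 * s := by linarith
  have hd2 : 0 < 2 * s - t := by linarith
  have hd3 : 0 < (N : ℝ) - t := by linarith
  have hstar : 0 < twoStar := by rw [htwoStar]; positivity
  have hstar2 : twoStar - 2 = 2 * (2 * s - t) / ((N : ℝ) - 2 * s) := by
    rw [htwoStar]
    field_simp
    ring
  have hq' : q = 2 * ((N : ℝ) - t) / (2 * s - t) := by
    rw [hq, hstar2, htwoStar]
    field_simp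
  have hq0 : 0 < q := by rw [hq']; positivity
  have ha : q * t / twoStar = t * ((N : ℝ) - 2 * s) / (2 * s - t) := by
    rw [hq', htwoStar]
    field_simp
  have ha0 : 0 ≤ q * t / twoStar := by positivity
  have hscal : q * t / twoStar + -s * q + N = 0 := by
    rw [ha, hq']
    field_simp
    ring
  set a := q * t / twoStar
  set K := ∫ z : EuclideanSpace ℝ (Fin N), Real.log (1 + ‖z‖) * ‖z‖ ^ (-((N : ℝ) + s)) with hK
  have hK0 : 0 ≤ K := integral_nonneg fun z => mul_nonneg
    (Real.log_nonneg (by linarith [norm_nonneg z])) (Real.rpow_nonneg (norm_nonneg z) _)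
  set V := (volume (Metric.ball (0 : EuclideanSpace ℝ (Fin N)) 1)).toReal with hV
  have hV0 : 0 ≤ V := ENNReal.toReal_nonneg
  have hVeq : volume (Metric.ball (0 : EuclideanSpace ℝ (Fin N)) 1) = ENNReal.ofReal V :=
    (ENNReal.ofReal_toReal measure_ball_lt_top.ne).symm
  refine ⟨K ^ q * V + 1, Real.exp 1, by positivity, Real.one_le_exp zero_le_one, ?_⟩
  intro r R hr hR hA
  have hL1 : 1 ≤ Real.log (R / r) := (Real.le_log_iff_exp_le (div_pos (hr.trans hR) hr)).2 hA
  set L := Real.log (R / r)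
  have hL0 : 0 < L := by linarith
  have hball : {x : EuclideanSpace ℝ (Fin N) | ‖x‖ < r} = Metric.ball 0 r := by
    ext x
    simp
  have hpoint : ∀ x ∈ Metric.ball (0 : EuclideanSpace ℝ (Fin N)) r,
      ENNReal.ofReal (‖x‖ ^ a * |cutoffFracLap N s r R x| ^ q)
        ≤ ENNReal.ofReal (r ^ a * (K * r ^ (-s) / L) ^ q) := by
    intro x hx
    have hxr : ‖x‖ < r := by simpa using hx
    exact ENNReal.ofReal_le_ofReal (mul_le_mul
      (Real.rpow_le_rpow (norm_nonneg x) hxr.le ha0)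
      (Real.rpow_le_rpow (abs_nonneg _) (abs_cutoffFracLap_le hNpos hs hr hR hxr) hq0.le)
      (by positivity) (by positivity))
  rw [hball]
  refine (setLIntegral_mono' measurableSet_ball hpoint).trans ?_
  rw [setLIntegral_const, Measure.addHaar_ball_of_pos volume 0 hr, finrank_euclideanSpace_fin, hVeq,
    ← ENNReal.ofReal_mul (by positivity), ← ENNReal.ofReal_mul (by positivity)]
  refine ENNReal.ofReal_le_ofReal ?_
  have hr1 : r ^ a * (r ^ (-s)) ^ q * r ^ N = 1 := by
    rw [← Real.rpow_mul hr.le, ← Real.rpow_natCast, ← Real.rpow_add hr, ← Real.rpow_add hr,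
      hscal, Real.rpow_zero]
  have hLq : L ^ (-q) ≤ L ^ (-(q / 2)) := Real.rpow_le_rpow_of_exponent_le hL1 (by linarith)
  calc r ^ a * (K * r ^ (-s) / L) ^ q * (r ^ N * V)
      = K ^ q * V * L ^ (-q) * (r ^ a * (r ^ (-s)) ^ q * r ^ N) := by
        rw [Real.div_rpow (by positivity) hL0.le, Real.mul_rpow hK0 (by positivity),
          Real.rpow_neg hL0.le]
        ring
    _ = K ^ q * V * L ^ (-q) := by rw [hr1, mul_one]
    _ ≤ (K ^ q * V + 1) * L ^ (-(q / 2)) := by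
        gcongr
        linarith
end

section
/- Let s ∈ (0,1), let N > 2s be an integer, and let t ∈ (0, 2s). Set 2* = 2(N−t)/(N−2s) and q = 2·2*/(2*−2). Then there exist constants C > 0 and A₀ ≥ 1, depending only on N, s, t, such that for all 0 < r < R with R/r ≥ A₀, the function F_{r,R}(x) = ∫_{ℝ^N} (φ_{r,R}(x) − φ_{r,R}(y)) |x−y|^{−(N+s)} dy satisfies ∫_{|x| > R} |x|^{qt/2*} |F_{r,R}(x)|^q dx ≤ C (log(R/r))^{−q/2}. -/
open MeasureTheory

lemma logCutoff_smul (N : ℕ) {r R : ℝ} (hR : 0 < R) (y : EuclideanSpace ℝ (Fin N)) :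
    logCutoff N r R (R • y) = logCutoff N (r / R) 1 y := by
  have h1 : R * ‖y‖ < r ↔ ‖y‖ < r / R := by rw [lt_div_iff₀ hR, mul_comm]
  have h2 : R * ‖y‖ ≤ R ↔ ‖y‖ ≤ 1 := by
    rw [← mul_le_mul_iff_right₀ hR (b := ‖y‖) (c := 1), mul_one]
  have h3 : R / (R * ‖y‖) = 1 / ‖y‖ := by rw [← div_div, div_self hR.ne']
  have h4 : 1 / (r / R) = R / r := by rw [one_div_div]
  simp only [logCutoff, norm_smul, Real.norm_of_nonneg hR.le, h1, h2, h3, h4]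

lemma cutoffFracLap_smul (N : ℕ) (s : ℝ) {r R : ℝ} (hR : 0 < R)
    (x : EuclideanSpace ℝ (Fin N)) :
    cutoffFracLap N s r R (R • x) = R ^ (-s) * cutoffFracLap N s (r / R) 1 x := by
  have h := Measure.integral_comp_smul_of_nonneg volume
    (fun y : EuclideanSpace ℝ (Fin N) =>
      (logCutoff N r R (R • x) - logCutoff N r R y) * ‖R • x - y‖ ^ (-((N : ℝ) + s))) R
    (hR := hR.le)
  rw [finrank_euclideanSpace_fin, smul_eq_mul, eq_comm, inv_mul_eq_iff_eq_mul₀ (by positivity)] at h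
  unfold cutoffFracLap
  rw [h, ← integral_const_mul, ← integral_const_mul]
  congr 1 with y
  rw [logCutoff_smul N hR, logCutoff_smul N hR, ← smul_sub, norm_smul, Real.norm_of_nonneg hR.le,
    Real.mul_rpow hR.le (norm_nonneg _)]
  have : R ^ (-s) = R ^ N * R ^ (-((N : ℝ) + s)) := by
    rw [← Real.rpow_natCast, ← Real.rpow_add hR]
    ring_nf
  rw [this]
  ring

lemma abs_logCutoff_le (N : ℕ) {δ : ℝ} (hδ : 0 < δ) (hδ1 : δ < 1)
    {y : EuclideanSpace ℝ (Fin N)} (hy : y ≠ 0) (hy1 : ‖y‖ < 1) :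
    |logCutoff N δ 1 y| ≤ Real.log (1 / ‖y‖) / Real.log (1 / δ) := by
  have hy0 : 0 < ‖y‖ := norm_pos_iff.mpr hy
  have hL : 0 < Real.log (1 / δ) := Real.log_pos (by rwa [lt_div_iff₀ hδ, one_mul])
  have hl : 0 < Real.log (1 / ‖y‖) := Real.log_pos (by rwa [lt_div_iff₀ hy0, one_mul])
  unfold logCutoff
  split_ifs with h1 h2
  · rw [abs_one, le_div_iff₀ hL, one_mul]
    exact Real.log_le_log (by positivity) (by gcongr)
  · exact (abs_of_nonneg (by positivity)).le
  · exact absurd hy1.le h2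

lemma logCutoff_eq_zero (N : ℕ) {δ : ℝ} (hδ1 : δ < 1) {y : EuclideanSpace ℝ (Fin N)}
    (hy1 : 1 ≤ ‖y‖) : logCutoff N δ 1 y = 0 := by
  unfold logCutoff
  split_ifs with h1 h2
  · linarith
  · simp [le_antisymm h2 hy1]
  · rfl

/-- `‖x‖ ^ (-β)` on the unit ball, extended by zero. -/
noncomputable def truncNormRpow (N : ℕ) (β : ℝ) : EuclideanSpace ℝ (Fin N) → ℝ :=
  (Metric.ball 0 1).indicator fun x => ‖x‖ ^ (-β)

lemma truncNormRpow_nonneg (N : ℕ) (β : ℝ) (x : EuclideanSpace ℝ (Fin N)) :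
    0 ≤ truncNormRpow N β x :=
  Set.indicator_nonneg (fun _ _ => by positivity) _

lemma truncNormRpow_of_lt {N : ℕ} (β : ℝ) {x : EuclideanSpace ℝ (Fin N)} (hx : ‖x‖ < 1) :
    truncNormRpow N β x = ‖x‖ ^ (-β) :=
  Set.indicator_of_mem (by simpa using hx) _

lemma integrable_truncNormRpow {N : ℕ} (hN : 1 ≤ N) {β : ℝ} (hβ : β < N) :
    Integrable (truncNormRpow N β) := by
  have h : IntegrableOn (fun x : EuclideanSpace ℝ (Fin N) => ‖x‖ ^ (-β)) (Metric.ball 0 1) := by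
    refine integrableOn_ball_of_norm_le_rpow (C := 1) (α := β) (by simpa using hN)
      (by simpa using hβ) ?_ ?_
    · refine Filter.Eventually.of_forall fun x => ?_
      rw [one_mul, Real.norm_of_nonneg (by positivity)]
    · exact Measurable.aestronglyMeasurable (by fun_prop)
  exact h.integrable_indicator measurableSet_ball

lemma log_one_div_mul_rpow_le {N : ℕ} {s : ℝ} (hs : 0 < s)
    {x y : EuclideanSpace ℝ (Fin N)} (hx : 1 < ‖x‖) (hy : y ≠ 0) (hy1 : ‖y‖ < 1) :
    Real.log (1 / ‖y‖) * ‖x - y‖ ^ (-((N : ℝ) + s)) ≤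
      2 ^ ((N : ℝ) + s + 1) * ‖x‖ ^ (-((N : ℝ) + s)) *
        (truncNormRpow N (1 / 2) y + truncNormRpow N (N + s - 1) (x - y)) := by
  have hy0 : 0 < ‖y‖ := norm_pos_iff.mpr hy
  have hx0 : 0 < ‖x‖ := by linarith
  have hxy : ‖x‖ - ‖y‖ ≤ ‖x - y‖ := norm_sub_norm_le x y
  have hxy0 : 0 < ‖x - y‖ := by linarith
  have hp : 0 < (N : ℝ) + s := by positivity
  set p : ℝ := (N : ℝ) + s
  have h2 : (2 : ℝ) ^ (p + 1) = 2 ^ p * 2 := by rw [Real.rpow_add_one (by norm_num)]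
  have ht1 := truncNormRpow_nonneg N (1 / 2) y
  have ht2 := truncNormRpow_nonneg N (p - 1) (x - y)
  rcases le_or_gt (‖x‖ / 2) ‖x - y‖ with h | h
  · have hlog : Real.log (1 / ‖y‖) ≤ 2 * truncNormRpow N (1 / 2) y := by
      rw [truncNormRpow_of_lt _ hy1]
      have := Real.log_le_rpow_div (x := 1 / ‖y‖) (by positivity) (ε := 1 / 2) (by norm_num)
      rw [one_div, Real.inv_rpow hy0.le, ← Real.rpow_neg hy0.le] at this
      rw [one_div]
      linarith
    have hker : ‖x - y‖ ^ (-p) ≤ 2 ^ p * ‖x‖ ^ (-p) := by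
      calc ‖x - y‖ ^ (-p) ≤ (‖x‖ / 2) ^ (-p) :=
            Real.rpow_le_rpow_of_nonpos (by positivity) h (by linarith)
        _ = 2 ^ p * ‖x‖ ^ (-p) := by
            rw [Real.div_rpow hx0.le (by norm_num), Real.rpow_neg (by norm_num : (0 : ℝ) ≤ 2),
              div_inv_eq_mul, mul_comm]
    calc Real.log (1 / ‖y‖) * ‖x - y‖ ^ (-p)
        ≤ (2 * truncNormRpow N (1 / 2) y) * (2 ^ p * ‖x‖ ^ (-p)) := by gcongr
      _ = 2 ^ p * 2 * ‖x‖ ^ (-p) * (truncNormRpow N (1 / 2) y + 0) := by ring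
      _ ≤ _ := by rw [h2]; gcongr
  · have hyhalf : 1 / 2 < ‖y‖ := by linarith
    have hx2 : ‖x‖ < 2 := by linarith
    have hlog : Real.log (1 / ‖y‖) ≤ 2 * ‖x - y‖ := by
      have h1 := Real.log_le_sub_one_of_pos (x := 1 / ‖y‖) (by positivity)
      have h3 : 1 / ‖y‖ - 1 ≤ 2 * (1 - ‖y‖) := by
        rw [sub_le_iff_le_add, div_le_iff₀ hy0]
        nlinarith
      linarith
    have hone : 1 ≤ 2 ^ p * ‖x‖ ^ (-p) := by
      rw [Real.rpow_neg hx0.le, ← div_eq_mul_inv, one_le_div (by positivity)]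
      gcongr
    have hker : ‖x - y‖ * ‖x - y‖ ^ (-p) = truncNormRpow N (p - 1) (x - y) := by
      rw [truncNormRpow_of_lt _ (by linarith), mul_comm, ← Real.rpow_add_one hxy0.ne']
      ring_nf
    calc Real.log (1 / ‖y‖) * ‖x - y‖ ^ (-p)
        ≤ 2 * ‖x - y‖ * ‖x - y‖ ^ (-p) := by gcongr
      _ = 1 * (2 * (0 + truncNormRpow N (p - 1) (x - y))) := by rw [← hker]; ring
      _ ≤ (2 ^ p * ‖x‖ ^ (-p)) *
            (2 * (truncNormRpow N (1 / 2) y + truncNormRpow N (p - 1) (x - y))) := by gcongr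
      _ = _ := by rw [h2]; ring

lemma exists_abs_cutoffFracLap_one_le {N : ℕ} (hN : 1 ≤ N) {s : ℝ} (hs : 0 < s) (hs1 : s < 1) :
    ∃ K : ℝ, 0 ≤ K ∧ ∀ δ : ℝ, 0 < δ → δ < 1 → ∀ x : EuclideanSpace ℝ (Fin N), 1 < ‖x‖ →
      |cutoffFracLap N s δ 1 x| ≤ K / Real.log (1 / δ) * ‖x‖ ^ (-((N : ℝ) + s)) := by
  have : Nonempty (Fin N) := ⟨⟨0, hN⟩⟩
  have hN' : (1 : ℝ) ≤ N := by exact_mod_cast hN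
  have hi1 := integrable_truncNormRpow hN (β := 1 / 2) (by linarith)
  have hi2 := integrable_truncNormRpow hN (β := N + s - 1) (by linarith)
  refine ⟨2 ^ ((N : ℝ) + s + 1) *
    ((∫ y, truncNormRpow N (1 / 2) y) + ∫ y, truncNormRpow N (N + s - 1) y), ?_, ?_⟩
  · exact mul_nonneg (by positivity) (add_nonneg
      (integral_nonneg (truncNormRpow_nonneg _ _)) (integral_nonneg (truncNormRpow_nonneg _ _)))
  intro δ hδ hδ1 x hx
  have hL : 0 < Real.log (1 / δ) := Real.log_pos (by rwa [lt_div_iff₀ hδ, one_mul])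
  have hi3 := hi2.comp_sub_left x
  have hbound : ‖cutoffFracLap N s δ 1 x‖ ≤ ∫ y, 2 ^ ((N : ℝ) + s + 1) *
      ‖x‖ ^ (-((N : ℝ) + s)) / Real.log (1 / δ) *
        (truncNormRpow N (1 / 2) y + truncNormRpow N (N + s - 1) (x - y)) := by
    refine norm_integral_le_of_norm_le ((hi1.add hi3).const_mul _) ?_
    filter_upwards [Measure.ae_ne volume 0] with y hy
    rw [logCutoff_eq_zero N hδ1 hx.le, zero_sub, norm_mul, norm_neg,
      Real.norm_of_nonneg (by positivity : 0 ≤ ‖x - y‖ ^ (-((N : ℝ) + s))), Real.norm_eq_abs]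
    rcases lt_or_ge ‖y‖ 1 with hy1 | hy1
    · calc |logCutoff N δ 1 y| * ‖x - y‖ ^ (-((N : ℝ) + s))
          ≤ Real.log (1 / ‖y‖) / Real.log (1 / δ) * ‖x - y‖ ^ (-((N : ℝ) + s)) := by
            gcongr
            exact abs_logCutoff_le N hδ hδ1 hy hy1
        _ = Real.log (1 / ‖y‖) * ‖x - y‖ ^ (-((N : ℝ) + s)) / Real.log (1 / δ) := by ring
        _ ≤ 2 ^ ((N : ℝ) + s + 1) * ‖x‖ ^ (-((N : ℝ) + s)) *
              (truncNormRpow N (1 / 2) y + truncNormRpow N (N + s - 1) (x - y)) /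
              Real.log (1 / δ) := by
            exact div_le_div_of_nonneg_right (log_one_div_mul_rpow_le hs hx hy hy1) hL.le
        _ = _ := by ring
    · rw [logCutoff_eq_zero N hδ1 hy1, abs_zero, zero_mul]
      exact mul_nonneg (by positivity)
        (add_nonneg (truncNormRpow_nonneg _ _ _) (truncNormRpow_nonneg _ _ _))
  rw [integral_const_mul, integral_add hi1 hi3,
    integral_sub_left_eq_self (truncNormRpow N (N + s - 1)) volume x] at hbound
  calc |cutoffFracLap N s δ 1 x| ≤ _ := hbound
    _ = _ := by ring

lemma exists_abs_cutoffFracLap_le {N : ℕ} (hN : 1 ≤ N) {s : ℝ} (hs : 0 < s) (hs1 : s < 1) :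
    ∃ K : ℝ, 0 ≤ K ∧ ∀ r R : ℝ, 0 < r → r < R → ∀ x : EuclideanSpace ℝ (Fin N), R < ‖x‖ →
      |cutoffFracLap N s r R x| ≤
        K / Real.log (R / r) * R ^ (-s) * (‖x‖ / R) ^ (-((N : ℝ) + s)) := by
  obtain ⟨K, hK, h⟩ := exists_abs_cutoffFracLap_one_le hN hs hs1
  refine ⟨K, hK, fun r R hr hrR x hx => ?_⟩
  have hR : 0 < R := hr.trans hrR
  have hnorm : ‖R⁻¹ • x‖ = ‖x‖ / R := by
    rw [norm_smul, Real.norm_of_nonneg (by positivity), inv_mul_eq_div]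
  have hb := h (r / R) (by positivity) (by rwa [div_lt_one hR]) (R⁻¹ • x)
    (by rwa [hnorm, one_lt_div hR])
  have hs := cutoffFracLap_smul N s (r := r) hR (R⁻¹ • x)
  rw [smul_inv_smul₀ hR.ne'] at hs
  rw [hnorm, one_div_div] at hb
  rw [hs, abs_mul, abs_of_nonneg (by positivity)]
  calc _ ≤ R ^ (-s) * (K / Real.log (R / r) * (‖x‖ / R) ^ (-((N : ℝ) + s))) := by gcongr
    _ = _ := by ring

lemma integrableOn_norm_rpow_one_lt (N : ℕ) {p : ℝ} (hp : (N : ℝ) < p) :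
    IntegrableOn (fun x : EuclideanSpace ℝ (Fin N) => ‖x‖ ^ (-p)) {x | 1 < ‖x‖} := by
  have hi := (integrable_one_add_norm (E := EuclideanSpace ℝ (Fin N)) (μ := volume) (r := p)
    (by simpa using hp)).const_mul (2 ^ p)
  have hp0 : 0 < p := (Nat.cast_nonneg N).trans_lt hp
  refine hi.integrableOn.mono' (Measurable.aestronglyMeasurable (by fun_prop)) ?_
  refine ae_restrict_of_forall_mem (measurableSet_lt measurable_const measurable_norm)
    fun x (hx : 1 < ‖x‖) => ?_
  rw [Real.norm_of_nonneg (by positivity)]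
  calc ‖x‖ ^ (-p) ≤ ((1 + ‖x‖) / 2) ^ (-p) :=
        Real.rpow_le_rpow_of_nonpos (by positivity) (by linarith) (by linarith)
    _ = 2 ^ p * (1 + ‖x‖) ^ (-p) := by
        rw [Real.div_rpow (by positivity) (by norm_num), Real.rpow_neg (by norm_num : (0 : ℝ) ≤ 2),
          div_inv_eq_mul, mul_comm]

lemma lintegral_norm_div_rpow_lt (N : ℕ) {p c R : ℝ} (hp : (N : ℝ) < p) (hc : 0 ≤ c)
    (hR : 0 < R) :
    ∫⁻ x in {x : EuclideanSpace ℝ (Fin N) | R < ‖x‖},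
        ENNReal.ofReal (c * (R ^ N)⁻¹ * (‖x‖ / R) ^ (-p)) =
      ENNReal.ofReal (c * ∫ x in {x : EuclideanSpace ℝ (Fin N) | 1 < ‖x‖}, ‖x‖ ^ (-p)) := by
  set h : EuclideanSpace ℝ (Fin N) → ℝ :=
    {x : EuclideanSpace ℝ (Fin N) | 1 < ‖x‖}.indicator fun x => ‖x‖ ^ (-p)
  have hm (a : ℝ) : MeasurableSet {x : EuclideanSpace ℝ (Fin N) | a < ‖x‖} :=
    measurableSet_lt measurable_const measurable_norm
  have hh : Integrable h := (integrableOn_norm_rpow_one_lt N hp).integrable_indicator (hm 1)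
  have hh0 : 0 ≤ h := fun x => Set.indicator_nonneg (fun _ _ => by positivity) _
  have heq : ∀ x : EuclideanSpace ℝ (Fin N),
      {x : EuclideanSpace ℝ (Fin N) | R < ‖x‖}.indicator
        (fun x => ENNReal.ofReal (c * (R ^ N)⁻¹ * (‖x‖ / R) ^ (-p))) x =
      ENNReal.ofReal (c * (R ^ N)⁻¹ * h (R⁻¹ • x)) := fun x => by
    have hnorm : ‖R⁻¹ • x‖ = ‖x‖ / R := by
      rw [norm_smul, Real.norm_of_nonneg (by positivity), inv_mul_eq_div]
    by_cases hx : R < ‖x‖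
    · simp [h, Set.indicator, hx, hnorm, one_lt_div hR]
    · simp [h, Set.indicator, hx, hnorm, one_lt_div hR]
  rw [← lintegral_indicator (hm R), lintegral_congr heq,
    ← ofReal_integral_eq_lintegral_ofReal ((hh.comp_smul (inv_ne_zero hR.ne')).const_mul _)
      (Filter.Eventually.of_forall fun x => mul_nonneg (by positivity) (hh0 _)),
    integral_const_mul, Measure.integral_comp_inv_smul_of_nonneg volume h hR.le,
    finrank_euclideanSpace_fin, integral_indicator (hm 1), smul_eq_mul]
  congr 1
  field_simp

/-- For `s ∈ (0,1)`, integer `N > 2s`, `t ∈ (0,2s)`,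
`2* = 2(N-t)/(N-2s)`, `q = 2·2*/(2*-2)`: there are `C > 0`, `A₀ ≥ 1` depending only on
`N, s, t` such that for all `0 < r < R` with `R/r ≥ A₀`,
`∫_{|x|>R} |x|^{qt/2*} |F_{r,R}(x)|^q dx ≤ C (log(R/r))^{-q/2}`. -/
theorem statement4 (N : ℕ) (s t : ℝ) (hs : s ∈ Set.Ioo (0 : ℝ) 1) (hN : 2 * s < N)
    (ht : t ∈ Set.Ioo (0 : ℝ) (2 * s)) (twoStar q : ℝ)
    (htwoStar : twoStar = 2 * ((N : ℝ) - t) / ((N : ℝ) - 2 * s))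
    (hq : q = 2 * twoStar / (twoStar - 2)) :
    ∃ C A₀ : ℝ, 0 < C ∧ 1 ≤ A₀ ∧ ∀ r R : ℝ, 0 < r → r < R → A₀ ≤ R / r →
      ∫⁻ x in {x : EuclideanSpace ℝ (Fin N) | R < ‖x‖},
          ENNReal.ofReal (‖x‖ ^ (q * t / twoStar) * |cutoffFracLap N s r R x| ^ q)
        ≤ ENNReal.ofReal (C * Real.log (R / r) ^ (-(q / 2))) := by
  obtain ⟨hs0, hs1⟩ := hs
  obtain ⟨ht0, ht1⟩ := ht
  have hN0 : (0 : ℝ) < N := by linarith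
  have hN1 : 1 ≤ N := by exact_mod_cast hN0
  have hts : 0 < 2 * s - t := by linarith
  have hNs : 0 < (N : ℝ) - 2 * s := by linarith
  have hNt : 0 < (N : ℝ) - t := by linarith
  have hsub : twoStar - 2 = 2 * (2 * s - t) / ((N : ℝ) - 2 * s) := by
    rw [htwoStar]
    field_simp
    ring
  have hq' : q = 2 * ((N : ℝ) - t) / (2 * s - t) := by
    rw [hq, hsub, htwoStar]
    field_simp
  have hq0 : 0 < q := by rw [hq']; positivity
  have hexp : q * t / twoStar = s * q - N := by
    rw [hq', htwoStar]
    field_simp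
    ring
  obtain ⟨K, hK, hF⟩ := exists_abs_cutoffFracLap_le hN1 hs0 hs1
  have hI : 0 ≤ ∫ x in {x : EuclideanSpace ℝ (Fin N) | 1 < ‖x‖}, ‖x‖ ^ (-((N : ℝ) + N * q)) :=
    integral_nonneg fun x => by positivity
  set I := ∫ x in {x : EuclideanSpace ℝ (Fin N) | 1 < ‖x‖}, ‖x‖ ^ (-((N : ℝ) + N * q))
  refine ⟨K ^ q * I + 1, Real.exp 1, by positivity, Real.one_le_exp zero_le_one,
    fun r R hr hrR hA => ?_⟩
  have hR : 0 < R := hr.trans hrR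
  have hL : 1 ≤ Real.log (R / r) := (Real.le_log_iff_exp_le (by positivity)).mpr hA
  set L := Real.log (R / r)
  have hL0 : 0 < L := by linarith
  calc ∫⁻ x in {x : EuclideanSpace ℝ (Fin N) | R < ‖x‖},
          ENNReal.ofReal (‖x‖ ^ (q * t / twoStar) * |cutoffFracLap N s r R x| ^ q)
      ≤ ∫⁻ x in {x : EuclideanSpace ℝ (Fin N) | R < ‖x‖}, ENNReal.ofReal
          ((K / L) ^ q * (R ^ N)⁻¹ * (‖x‖ / R) ^ (-((N : ℝ) + N * q))) := by
        refine setLIntegral_mono' (measurableSet_lt measurable_const measurable_norm)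
          fun x (hx : R < ‖x‖) => ENNReal.ofReal_le_ofReal ?_
        have hx0 : 0 < ‖x‖ := hR.trans hx
        have hu : 0 < ‖x‖ / R := by positivity
        have hxu : ‖x‖ = R * (‖x‖ / R) := by field_simp
        calc ‖x‖ ^ (q * t / twoStar) * |cutoffFracLap N s r R x| ^ q
            ≤ ‖x‖ ^ (q * t / twoStar) *
                (K / L * R ^ (-s) * (‖x‖ / R) ^ (-((N : ℝ) + s))) ^ q := by
              gcongr
              exact hF r R hr hrR x hx
          _ = (R * (‖x‖ / R)) ^ (s * q - N) *
                (K / L * R ^ (-s) * (‖x‖ / R) ^ (-((N : ℝ) + s))) ^ q := by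
              rw [hexp, ← hxu]
          _ = (K / L) ^ q * (R ^ (s * q - N) * R ^ (-s * q)) *
                ((‖x‖ / R) ^ (s * q - N) * (‖x‖ / R) ^ (-((N : ℝ) + s) * q)) := by
              rw [Real.mul_rpow hR.le hu.le, Real.mul_rpow (by positivity) (by positivity),
                Real.mul_rpow (by positivity) (by positivity), ← Real.rpow_mul hR.le,
                ← Real.rpow_mul hu.le]
              ring
          _ = (K / L) ^ q * (R ^ N)⁻¹ * (‖x‖ / R) ^ (-((N : ℝ) + N * q)) := by
              rw [← Real.rpow_add hR, ← Real.rpow_add hu, ← Real.rpow_natCast R N,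
                ← Real.rpow_neg hR.le]
              ring_nf
    _ = ENNReal.ofReal ((K / L) ^ q * I) :=
        lintegral_norm_div_rpow_lt N (lt_add_of_pos_right _ (by positivity)) (by positivity) hR
    _ ≤ ENNReal.ofReal ((K ^ q * I + 1) * L ^ (-(q / 2))) := by
        refine ENNReal.ofReal_le_ofReal ?_
        calc (K / L) ^ q * I = K ^ q * I * L ^ (-q) := by
              rw [Real.div_rpow hK hL0.le, Real.rpow_neg hL0.le]
              ring
          _ ≤ (K ^ q * I + 1) * L ^ (-(q / 2)) := by
              gcongr
              · linarith
              · linarith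
end
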